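/- arXiv:math/0312152 — 2 statements merged into one kernel-verified Lean document; each statement's English description precedes it below -/
import Mathlib

section
/- Let Λ be a finitely aligned k-graph, let v be a vertex of Λ, let E ⊆ vΛ be finite and exhaustive, and let μ ∈ vΛ. Then Ext(μ;E) is a finite exhaustive subset of s(μ)Λ. Moreover, μ ∈ EΛ if and only if s(μ) ∈ Ext(μ;E). -/
open scoped ENNReal

attribute [local instance] Classical.propDecidable

/-- Product of `f` over a set `S`, in some arbitrary order (junk value `1` if `S` is
infinite).  Used for products of commuting projections. -/
noncomputable def listProd {ι A : Type*} [Monoid A] (S : Set ι) (f : ι → A) : A :=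
  if h : S.Finite then (h.toFinset.toList.map f).prod else 1

/-- A `k`-graph: a countable category `Λ` (whose morphisms are the terms of `Path`, with
vertices identified with the morphisms of degree `0`) together with a degree functor
`d : Λ → ℕ^k` satisfying the factorisation property. -/
structure KGraph (k : ℕ) where
  Path : Type
  countable : Countable Path
  d : Path → Fin k → ℕ
  r : Path → Path
  s : Path → Path
  comp : Path → Path → Path
  d_r : ∀ lam, d (r lam) = 0
  d_s : ∀ lam, d (s lam) = 0
  r_r : ∀ lam, r (r lam) = r lam
  s_r : ∀ lam, s (r lam) = r lam
  r_s : ∀ lam, r (s lam) = s lam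
  s_s : ∀ lam, s (s lam) = s lam
  comp_source : ∀ lam, comp lam (s lam) = lam
  range_comp : ∀ lam, comp (r lam) lam = lam
  r_comp : ∀ lam mu, s lam = r mu → r (comp lam mu) = r lam
  s_comp : ∀ lam mu, s lam = r mu → s (comp lam mu) = s mu
  d_comp : ∀ lam mu, s lam = r mu → d (comp lam mu) = d lam + d mu
  comp_assoc : ∀ lam mu nu, s lam = r mu → s mu = r nu →
    comp (comp lam mu) nu = comp lam (comp mu nu)
  factor : ∀ lam m n, d lam = m + n →
    ∃! p : Path × Path, s p.1 = r p.2 ∧ d p.1 = m ∧ d p.2 = n ∧ comp p.1 p.2 = lam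

namespace KGraph

variable {k : ℕ} (Λ : KGraph k)

/-- Vertices are identified with the paths of degree `0`. -/
def IsVertex (v : Λ.Path) : Prop := Λ.d v = 0

/-- The unique factorisation of `lam` as a product of a path of degree `m` and the
remaining tail (junk value if `¬ m ≤ d lam`). -/
noncomputable def split (lam : Λ.Path) (m : Fin k → ℕ) : Λ.Path × Λ.Path :=
  if h : m ≤ Λ.d lam then
    (Λ.factor lam m (Λ.d lam - m) (by
      funext i
      exact (Nat.add_sub_cancel' (h i)).symm)).choose
  else (lam, lam)

/-- The segment `λ(m,n)` of the path `λ`: the unique path of degree `n - m` such that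
`λ = λ(0,m) λ(m,n) λ(n, d λ)` (meaningful for `m ≤ n ≤ d λ`). -/
noncomputable def seg (lam : Λ.Path) (m n : Fin k → ℕ) : Λ.Path :=
  (Λ.split (Λ.split lam n).1 m).2

/-- `MCE(μ,ν)`: minimal common extensions of `μ` and `ν`. -/
def MCE (mu nu : Λ.Path) : Set Λ.Path :=
  {lam | Λ.d lam = Λ.d mu ⊔ Λ.d nu ∧ Λ.seg lam 0 (Λ.d mu) = mu ∧ Λ.seg lam 0 (Λ.d nu) = nu}

/-- `Λ^min(μ,ν) = {(α,β) : μα = νβ ∈ MCE(μ,ν)}`. -/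
def Lmin (mu nu : Λ.Path) : Set (Λ.Path × Λ.Path) :=
  {p | Λ.s mu = Λ.r p.1 ∧ Λ.s nu = Λ.r p.2 ∧ Λ.comp mu p.1 = Λ.comp nu p.2 ∧
    Λ.comp mu p.1 ∈ Λ.MCE mu nu}

/-- `Ext(μ;E)`: extensions of `μ` with respect to `E`. -/
def Ext (mu : Λ.Path) (E : Set Λ.Path) : Set Λ.Path :=
  {a | Λ.r a = Λ.s mu ∧ ∃ nu ∈ E, ∃ b, (a, b) ∈ Λ.Lmin mu nu}

/-- `Λ` is finitely aligned if all the sets `MCE(μ,ν)` are finite. -/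
def FinitelyAligned : Prop := ∀ mu nu, (Λ.MCE mu nu).Finite

/-- `E ⊆ vΛ` is exhaustive if `Ext(λ;E) ≠ ∅` for all `λ ∈ vΛ`. -/
def Exhaustive (v : Λ.Path) (E : Set Λ.Path) : Prop :=
  ∀ lam, Λ.r lam = v → (Λ.Ext lam E).Nonempty

/-- `E ∈ vFE(Λ)`: `E ⊆ vΛ \ {v}` is finite and exhaustive (so `r(E) = v`). -/
def FEat (v : Λ.Path) (E : Set Λ.Path) : Prop :=
  Λ.IsVertex v ∧ (∀ lam ∈ E, Λ.r lam = v ∧ lam ≠ v) ∧ E.Finite ∧ Λ.Exhaustive v E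

/-- `FE(Λ)`: the finite exhaustive sets. -/
def FE : Set (Set Λ.Path) := {E | ∃ v, Λ.FEat v E}

/-- `λE = {λμ : μ ∈ E, r(μ) = s(λ)}`. -/
def lamSet (lam : Λ.Path) (E : Set Λ.Path) : Set Λ.Path :=
  {x | ∃ mu ∈ E, Λ.s lam = Λ.r mu ∧ Λ.comp lam mu = x}

/-- `EΛ = {λμ : λ ∈ E, r(μ) = s(λ)}`. -/
def setLam (E : Set Λ.Path) : Set Λ.Path :=
  {x | ∃ lam ∈ E, ∃ mu, Λ.s lam = Λ.r mu ∧ Λ.comp lam mu = x}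

/-- `𝓔 ⊆ FE(Λ)` is satiated if it satisfies (S1)--(S4). -/
def Satiated (𝓔 : Set (Set Λ.Path)) : Prop :=
  𝓔 ⊆ Λ.FE ∧
  (∀ G ∈ 𝓔, ∀ E ∈ Λ.FE, G ⊆ E → E ∈ 𝓔) ∧
  (∀ G ∈ 𝓔, ∀ v, Λ.FEat v G → ∀ mu, Λ.r mu = v → mu ∉ Λ.setLam G → Λ.Ext mu G ∈ 𝓔) ∧
  (∀ G ∈ 𝓔, ∀ n : Λ.Path → Fin k → ℕ, (∀ lam ∈ G, 0 < n lam ∧ n lam ≤ Λ.d lam) →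
    ((fun lam => Λ.seg lam 0 (n lam)) '' G) ∈ 𝓔) ∧
  (∀ G ∈ 𝓔, ∀ G' ⊆ G, ∀ Gl : Λ.Path → Set Λ.Path,
    (∀ lam ∈ G', Gl lam ∈ 𝓔 ∧ Λ.FEat (Λ.s lam) (Gl lam)) →
    ((G \ G') ∪ ⋃ lam ∈ G', Λ.lamSet lam (Gl lam)) ∈ 𝓔)

/-- The satiation `𝓔̄` of `𝓔`: the smallest satiated subset of `FE(Λ)` containing `𝓔`. -/
def satiation (𝓔 : Set (Set Λ.Path)) : Set (Set Λ.Path) :=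
  ⋂₀ {F | 𝓔 ⊆ F ∧ Λ.Satiated F}

/-- `ΠE`: the smallest subset of `Λ` containing `E` which is closed under the operation
`(λ,μ,σ) ↦ λ Ext(μ;{σ})` for `λ,μ,σ ∈ ΠE` with `d(λ) = d(μ)`, `s(λ) = s(μ)`. -/
def PiSet (E : Set Λ.Path) : Set Λ.Path :=
  ⋂₀ {G | E ⊆ G ∧ ∀ lam mu sig, lam ∈ G → mu ∈ G → sig ∈ G →
    Λ.d lam = Λ.d mu → Λ.s lam = Λ.s mu → Λ.lamSet lam (Λ.Ext mu {sig}) ⊆ G}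

/-- `Σ₁(𝓔)`: finite sets `F ⊆ r(E)Λ \ Λ⁰` containing some `E ∈ 𝓔`. -/
def Sig1 (𝓔 : Set (Set Λ.Path)) : Set (Set Λ.Path) :=
  {F | ∃ E ∈ 𝓔, ∃ v, Λ.FEat v E ∧ E ⊆ F ∧ F.Finite ∧
    ∀ lam ∈ F, Λ.r lam = v ∧ ¬ Λ.IsVertex lam}

/-- `Σ₂(𝓔) = {Ext(μ;E) : E ∈ 𝓔, μ ∈ r(E)Λ \ EΛ}`. -/
def Sig2 (𝓔 : Set (Set Λ.Path)) : Set (Set Λ.Path) :=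
  {F | ∃ E ∈ 𝓔, ∃ v, Λ.FEat v E ∧ ∃ mu, Λ.r mu = v ∧ mu ∉ Λ.setLam E ∧ F = Λ.Ext mu E}

/-- `Σ₃(𝓔) = {{λ(0,n_λ) : λ ∈ E} : E ∈ 𝓔, 0 < n_λ ≤ d(λ)}`. -/
def Sig3 (𝓔 : Set (Set Λ.Path)) : Set (Set Λ.Path) :=
  {F | ∃ E ∈ 𝓔, ∃ n : Λ.Path → Fin k → ℕ, (∀ lam ∈ E, 0 < n lam ∧ n lam ≤ Λ.d lam) ∧
    F = (fun lam => Λ.seg lam 0 (n lam)) '' E}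

/-- `Σ₄(𝓔) = {(E \ F) ∪ ⋃_{λ ∈ F} λ F_λ : E ∈ 𝓔, F ⊆ E, F_λ ∈ s(λ)𝓔}`. -/
def Sig4 (𝓔 : Set (Set Λ.Path)) : Set (Set Λ.Path) :=
  {G | ∃ E ∈ 𝓔, ∃ F ⊆ E, ∃ Fl : Λ.Path → Set Λ.Path,
    (∀ lam ∈ F, Fl lam ∈ 𝓔 ∧ Λ.FEat (Λ.s lam) (Fl lam)) ∧
    G = (E \ F) ∪ ⋃ lam ∈ F, Λ.lamSet lam (Fl lam)}

/-- `Σ = Σ₄ ∘ Σ₃ ∘ Σ₂ ∘ Σ₁`. -/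
def SigmaStep (𝓔 : Set (Set Λ.Path)) : Set (Set Λ.Path) :=
  Λ.Sig4 (Λ.Sig3 (Λ.Sig2 (Λ.Sig1 𝓔)))

/-- `Σ^∞(𝓔) = ⋃_{n ≥ 1} Σ^n(𝓔)`. -/
def SigmaInf (𝓔 : Set (Set Λ.Path)) : Set (Set Λ.Path) :=
  ⋃ n : ℕ, (Λ.SigmaStep)^[n + 1] 𝓔

section StarAlgebra

variable {A : Type*} [Ring A] [StarRing A]

/-- The product `∏_{λ ∈ E} (t_v - t_λ t_λ*)` (the factors pairwise commute for any
family satisfying (TCK1)--(TCK3), so the implicit choice of ordering is immaterial). -/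
noncomputable def gapProd (t : Λ.Path → A) (v : Λ.Path) (E : Set Λ.Path) : A :=
  listProd E fun lam => t v - t lam * star (t lam)

/-- Conditions (TCK1)--(TCK3) on a family `{t_λ}`. -/
def TCKFamily (t : Λ.Path → A) : Prop :=
  (∀ v, Λ.IsVertex v → star (t v) = t v ∧ t v * t v = t v) ∧
  (∀ v w, Λ.IsVertex v → Λ.IsVertex w → v ≠ w → t v * t w = 0) ∧
  (∀ lam mu, Λ.s lam = Λ.r mu → t lam * t mu = t (Λ.comp lam mu)) ∧
  (∀ lam mu, star (t lam) * t mu = ∑ᶠ p ∈ Λ.Lmin lam mu, t p.1 * star (t p.2))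

/-- A relative Cuntz-Krieger `(Λ;𝓔)`-family: (TCK1)--(TCK3) together with (CK). -/
def RCKFamily (𝓔 : Set (Set Λ.Path)) (t : Λ.Path → A) : Prop :=
  Λ.TCKFamily t ∧ ∀ E ∈ 𝓔, ∀ v, Λ.FEat v E → Λ.gapProd t v E = 0

/-- `Θ(t)^{ΠE}_{λ,μ} = t_λ (∏_{λν ∈ ΠE, d(ν) > 0} (t_{s(λ)} - t_ν t_ν*)) t_μ*`. -/
noncomputable def Theta (t : Λ.Path → A) (E : Set Λ.Path) (lam mu : Λ.Path) : A :=
  t lam *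
    listProd {nu | Λ.s lam = Λ.r nu ∧ ¬ Λ.IsVertex nu ∧ Λ.comp lam nu ∈ Λ.PiSet E}
      (fun nu => t (Λ.s lam) - t nu * star (t nu)) *
    star (t mu)

end StarAlgebra

end KGraph

/-- A graph morphism `x : Ω_{k,m} → Λ`, encoded by its length `m = d(x) ∈ (ℕ∪{∞})^k`
and its values `x(p,q)` on the morphisms `(p,q)` of `Ω_{k,m}` (with the junk value
`x(0,0)` outside the meaningful domain, so graph morphisms are extensional). -/
structure GMor {k : ℕ} (Λ : KGraph k) where
  len : Fin k → ℕ∞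
  seg : (Fin k → ℕ) → (Fin k → ℕ) → Λ.Path
  d_seg : ∀ p q, p ≤ q → (∀ i, (q i : ℕ∞) ≤ len i) → Λ.d (seg p q) = q - p
  r_seg : ∀ p q, p ≤ q → (∀ i, (q i : ℕ∞) ≤ len i) → Λ.r (seg p q) = seg p p
  s_seg : ∀ p q, p ≤ q → (∀ i, (q i : ℕ∞) ≤ len i) → Λ.s (seg p q) = seg q q
  comp_seg : ∀ p q u, p ≤ q → q ≤ u → (∀ i, (u i : ℕ∞) ≤ len i) →
    Λ.comp (seg p q) (seg q u) = seg p u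
  seg_junk : ∀ p q, ¬ (p ≤ q ∧ ∀ i, (q i : ℕ∞) ≤ len i) → seg p q = seg 0 0

namespace GMor

variable {k : ℕ} {Λ : KGraph k}

/-- The range `r(x) = x(0)` of a graph morphism. -/
def range (x : GMor Λ) : Λ.Path := x.seg 0 0

/-- `y = x|_n^{d(x)}`, the restriction of `x` (defined for `n ≤ d(x)`):
`d(y) = d(x) - n` and `y(p,q) = x(n+p, n+q)`. -/
def IsRestriction (y x : GMor Λ) (n : Fin k → ℕ) : Prop :=
  (∀ i, y.len i = x.len i - (n i : ℕ∞)) ∧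
  ∀ p q, p ≤ q → (∀ i, (q i : ℕ∞) ≤ y.len i) → y.seg p q = x.seg (n + p) (n + q)

/-- `y = λx`, the extension of `x` by `λ ∈ Λ r(x)`: `d(y) = d(λ) + d(x)`,
`y(0, d(λ)) = λ` and `y(d(λ), d(λ)+n) = x(0,n)` for `n ≤ d(x)`. -/
def IsExtension (y : GMor Λ) (lam : Λ.Path) (x : GMor Λ) : Prop :=
  (∀ i, y.len i = (Λ.d lam i : ℕ∞) + x.len i) ∧
  y.seg 0 (Λ.d lam) = lam ∧
  ∀ n : Fin k → ℕ, (∀ i, (n i : ℕ∞) ≤ x.len i) →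
    y.seg (Λ.d lam) (Λ.d lam + n) = x.seg 0 n

/-- `x ∈ FΛ^∞`: `x` has an initial segment belonging to `F`. -/
def HasInit (x : GMor Λ) (F : Set Λ.Path) : Prop :=
  ∃ lam ∈ F, (∀ i, (Λ.d lam i : ℕ∞) ≤ x.len i) ∧ x.seg 0 (Λ.d lam) = lam

/-- `z` restricts to `x` on `Ω_{k, d(x)}`. -/
def Agrees (z x : GMor Λ) : Prop :=
  ∀ p q, p ≤ q → (∀ i, (q i : ℕ∞) ≤ x.len i) → z.seg p q = x.seg p q

/-- `z ∈ MCE(x,y)` for graph morphisms `x, y`. -/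
def IsMCE (z x y : GMor Λ) : Prop :=
  (∀ i, z.len i = max (x.len i) (y.len i)) ∧ z.Agrees x ∧ z.Agrees y

/-- `x` is aperiodic: for distinct `λ, μ ∈ Λ r(x)`, `MCE(λx, μx) = ∅`. -/
def Aperiodic (x : GMor Λ) : Prop :=
  ∀ lam mu : Λ.Path, lam ≠ mu → Λ.s lam = x.range → Λ.s mu = x.range →
    ∀ lx mx : GMor Λ, lx.IsExtension lam x → mx.IsExtension mu x →
      ∀ z : GMor Λ, ¬ z.IsMCE lx mx

end GMor

namespace KGraph

variable {k : ℕ} (Λ : KGraph k)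

/-- `x ∈ ∂(Λ;𝓔)`: an `𝓔`-compatible boundary path. -/
def IsBdry (𝓔 : Set (Set Λ.Path)) (x : GMor Λ) : Prop :=
  ∀ n : Fin k → ℕ, (∀ i, (n i : ℕ∞) ≤ x.len i) →
    ∀ E ∈ 𝓔, Λ.FEat (x.seg n n) E →
      ∃ lam ∈ E, (∀ i, ((n + Λ.d lam) i : ℕ∞) ≤ x.len i) ∧ x.seg n (n + Λ.d lam) = lam

/-- Condition (C): aperiodic `𝓔`-compatible boundary paths out of every vertex, and
avoiding any given `F ∈ vFE(Λ) \ 𝓔`. -/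
def CondC (𝓔 : Set (Set Λ.Path)) : Prop :=
  (∀ v, Λ.IsVertex v → ∃ x : GMor Λ, Λ.IsBdry 𝓔 x ∧ x.range = v ∧ x.Aperiodic) ∧
  (∀ v F, Λ.FEat v F → F ∉ 𝓔 →
    ∃ x : GMor Λ, Λ.IsBdry 𝓔 x ∧ x.range = v ∧ ¬ x.HasInit F ∧ x.Aperiodic)

end KGraph

namespace KGraph

variable {k : ℕ} {Λ : KGraph k}

theorem comp_inj {a b a' b' : Λ.Path} (h : Λ.s a = Λ.r b) (h' : Λ.s a' = Λ.r b')
    (hd : Λ.d a = Λ.d a') (hc : Λ.comp a b = Λ.comp a' b') : a = a' ∧ b = b' := by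
  have hd' : Λ.d b' = Λ.d b := by
    have := Λ.d_comp a' b' h'
    rw [← hc, Λ.d_comp a b h, hd] at this
    exact (add_left_cancel this).symm
  have := (Λ.factor (Λ.comp a b) (Λ.d a) (Λ.d b) (Λ.d_comp a b h)).unique
    (y₁ := (a, b)) (y₂ := (a', b')) ⟨h, rfl, rfl, rfl⟩ ⟨h', hd.symm, hd', hc.symm⟩
  exact ⟨congrArg Prod.fst this, congrArg Prod.snd this⟩

theorem exists_comp_of_le (lam : Λ.Path) {m : Fin k → ℕ} (hm : m ≤ Λ.d lam) :
    ∃ a b, Λ.s a = Λ.r b ∧ Λ.d a = m ∧ Λ.comp a b = lam := by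
  obtain ⟨p, ⟨h₁, h₂, -, h₄⟩, -⟩ :=
    Λ.factor lam m (Λ.d lam - m) (add_tsub_cancel_of_le hm).symm
  exact ⟨p.1, p.2, h₁, h₂, h₄⟩

theorem split_spec (lam : Λ.Path) {m : Fin k → ℕ} (hm : m ≤ Λ.d lam) :
    Λ.s (Λ.split lam m).1 = Λ.r (Λ.split lam m).2 ∧ Λ.d (Λ.split lam m).1 = m ∧
      Λ.comp (Λ.split lam m).1 (Λ.split lam m).2 = lam := by
  have hsplit := (Λ.factor lam m (Λ.d lam - m) (add_tsub_cancel_of_le hm).symm).choose_spec.1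
  rw [split, dif_pos hm]
  exact ⟨hsplit.1, hsplit.2.1, hsplit.2.2.2⟩

theorem split_comp {a b : Λ.Path} (h : Λ.s a = Λ.r b) :
    Λ.split (Λ.comp a b) (Λ.d a) = (a, b) := by
  have hm : Λ.d a ≤ Λ.d (Λ.comp a b) := by
    rw [Λ.d_comp a b h]; exact le_self_add
  obtain ⟨h₁, h₂, h₃⟩ := Λ.split_spec (Λ.comp a b) hm
  obtain ⟨ha, hb⟩ := comp_inj h₁ h h₂ h₃
  exact Prod.ext ha hb

theorem split_zero_snd (lam : Λ.Path) : (Λ.split lam 0).2 = lam := by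
  have h := split_comp (Λ.s_r lam)
  rw [Λ.range_comp, Λ.d_r] at h
  rw [h]

theorem seg_zero_eq_iff {lam a : Λ.Path} (h : Λ.d a ≤ Λ.d lam) :
    Λ.seg lam 0 (Λ.d a) = a ↔ ∃ b, Λ.s a = Λ.r b ∧ Λ.comp a b = lam := by
  rw [seg, split_zero_snd]
  constructor
  · intro ha
    obtain ⟨h₁, -, h₃⟩ := Λ.split_spec lam h
    rw [ha] at h₁ h₃
    exact ⟨_, h₁, h₃⟩
  · rintro ⟨b, hb, rfl⟩
    rw [split_comp hb]

theorem mem_Lmin_iff {mu nu a b : Λ.Path} :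
    (a, b) ∈ Λ.Lmin mu nu ↔ Λ.s mu = Λ.r a ∧ Λ.s nu = Λ.r b ∧
      Λ.comp mu a = Λ.comp nu b ∧ Λ.d (Λ.comp mu a) = Λ.d mu ⊔ Λ.d nu := by
  constructor
  · rintro ⟨h₁, h₂, h₃, h₄⟩
    exact ⟨h₁, h₂, h₃, h₄.1⟩
  · rintro ⟨h₁, h₂, h₃, h₄⟩
    exact ⟨h₁, h₂, h₃, h₄, (seg_zero_eq_iff (h₄ ▸ le_sup_left)).2 ⟨a, h₁, rfl⟩,
      (seg_zero_eq_iff (h₄ ▸ le_sup_right)).2 ⟨b, h₂, h₃.symm⟩⟩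

theorem exists_comp_eq_of_d_le {a b y z : Λ.Path} (h : Λ.s a = Λ.r b) (h' : Λ.s y = Λ.r z)
    (hc : Λ.comp a b = Λ.comp y z) (hd : Λ.d a ≤ Λ.d y) :
    ∃ c, Λ.s a = Λ.r c ∧ Λ.comp a c = y ∧ Λ.s c = Λ.r z ∧ b = Λ.comp c z := by
  obtain ⟨a', c, hac, had, rfl⟩ := Λ.exists_comp_of_le y hd
  have hcz : Λ.s c = Λ.r z := by rw [← h', Λ.s_comp a' c hac]
  rw [Λ.comp_assoc a' c z hac hcz] at hc
  obtain ⟨rfl, rfl⟩ := comp_inj h (by rw [hac, Λ.r_comp c z hcz]) had.symm hc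
  exact ⟨c, hac, rfl, hcz, rfl⟩

/-- Every common extension of `mu` and `nu` factors through a minimal one. -/
theorem exists_mem_Lmin {mu nu a b : Λ.Path} (ha : Λ.s mu = Λ.r a) (hb : Λ.s nu = Λ.r b)
    (hc : Λ.comp mu a = Λ.comp nu b) :
    ∃ α β z, (α, β) ∈ Λ.Lmin mu nu ∧ Λ.s α = Λ.r z ∧ a = Λ.comp α z := by
  have hle : Λ.d mu ⊔ Λ.d nu ≤ Λ.d (Λ.comp mu a) := by
    refine sup_le ?_ ?_
    · rw [Λ.d_comp mu a ha]; exact le_self_add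
    · rw [hc, Λ.d_comp nu b hb]; exact le_self_add
  obtain ⟨y, z, hyz, hyd, hy⟩ := Λ.exists_comp_of_le _ hle
  obtain ⟨α, h₁, h₂, h₃, h₄⟩ := exists_comp_eq_of_d_le ha hyz hy.symm (hyd ▸ le_sup_left)
  obtain ⟨β, h₅, h₆, -, -⟩ :=
    exists_comp_eq_of_d_le hb hyz (hc.symm.trans hy.symm) (hyd ▸ le_sup_right)
  exact ⟨α, β, z, mem_Lmin_iff.2 ⟨h₁, h₅, h₂.trans h₆.symm, by rw [h₂, hyd]⟩, h₃, h₄⟩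

theorem finite_Ext (hΛ : Λ.FinitelyAligned) {E : Set Λ.Path} (hE : E.Finite) (mu : Λ.Path) :
    (Λ.Ext mu E).Finite := by
  refine Set.Finite.of_finite_image (f := Λ.comp mu)
    ((hE.biUnion fun nu _ => hΛ mu nu).subset ?_) ?_
  · rintro _ ⟨a, ⟨-, nu, hnu, b, hab⟩, rfl⟩
    exact Set.mem_biUnion hnu hab.2.2.2
  · intro a ha b hb hab
    exact (comp_inj ha.1.symm hb.1.symm rfl hab).2

theorem Exhaustive.ext {E : Set Λ.Path} {mu : Λ.Path} (hE : Λ.Exhaustive (Λ.r mu) E) :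
    Λ.Exhaustive (Λ.s mu) (Λ.Ext mu E) := by
  intro lam hlam
  obtain ⟨a, -, nu, hnu, b, hab⟩ := hE (Λ.comp mu lam) (Λ.r_comp mu lam hlam.symm)
  obtain ⟨ha, hb, hc, -⟩ := mem_Lmin_iff.1 hab
  rw [Λ.s_comp mu lam hlam.symm] at ha
  rw [Λ.comp_assoc mu lam a hlam.symm ha] at hc
  obtain ⟨α, β, z, hαβ, hz, heq⟩ :=
    exists_mem_Lmin (by rw [Λ.r_comp lam a ha, hlam]) hb hc
  obtain ⟨γ, δ, -, hγδ, -, -⟩ := exists_mem_Lmin ha hz heq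
  exact ⟨γ, hγδ.1.symm, α, ⟨hαβ.1.symm, nu, hnu, β, hαβ⟩, δ, hγδ⟩

theorem mem_setLam_iff_s_mem_Ext {E : Set Λ.Path} {mu : Λ.Path} :
    mu ∈ Λ.setLam E ↔ Λ.s mu ∈ Λ.Ext mu E := by
  constructor
  · rintro ⟨nu, hnu, b, hb, rfl⟩
    refine ⟨Λ.r_s _, nu, hnu, b, mem_Lmin_iff.2 ⟨(Λ.r_s _).symm, hb, Λ.comp_source _, ?_⟩⟩
    rw [Λ.comp_source, Λ.d_comp nu b hb, sup_eq_left.2 le_self_add]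
  · rintro ⟨-, nu, hnu, b, -, hb, hc, -⟩
    exact ⟨nu, hnu, b, hb, hc.symm.trans (Λ.comp_source mu)⟩

end KGraph

/-- Lemma 2.3: if `Λ` is a finitely aligned `k`-graph, `v` a vertex,
`E ⊆ vΛ` finite and exhaustive and `μ ∈ vΛ`, then `Ext(μ;E)` is a finite exhaustive
subset of `s(μ)Λ`; moreover `μ ∈ EΛ` iff `s(μ) ∈ Ext(μ;E)`. -/
theorem statement0 {k : ℕ} (Λ : KGraph k) (hΛ : Λ.FinitelyAligned)
    (v : Λ.Path) (hv : Λ.IsVertex v)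
    (E : Set Λ.Path) (hEsub : ∀ lam ∈ E, Λ.r lam = v) (hEfin : E.Finite)
    (hEex : Λ.Exhaustive v E)
    (mu : Λ.Path) (hmu : Λ.r mu = v) :
    (Λ.Ext mu E).Finite ∧ (∀ a ∈ Λ.Ext mu E, Λ.r a = Λ.s mu) ∧
      Λ.Exhaustive (Λ.s mu) (Λ.Ext mu E) ∧
      (mu ∈ Λ.setLam E ↔ Λ.s mu ∈ Λ.Ext mu E) := by
  subst hmu
  exact ⟨KGraph.finite_Ext hΛ hEfin mu, fun a ha => ha.1, hEex.ext,
    KGraph.mem_setLam_iff_s_mem_Ext⟩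
end

section
/- Let Λ be a finitely aligned k-graph, let 𝓔 ⊆ FE(Λ) be satiated, and let x ∈ ∂(Λ;𝓔). If λ ∈ Λr(x), then the extended path λx belongs to ∂(Λ;𝓔). -/
open scoped ENNReal

attribute [local instance] Classical.propDecidable

namespace KGraph

variable {k : ℕ} {Λ : KGraph k}

theorem exists_comp (lam : Λ.Path) {m : Fin k → ℕ} (hm : m ≤ Λ.d lam) :
    ∃ a b, Λ.s a = Λ.r b ∧ Λ.d a = m ∧ Λ.d b = Λ.d lam - m ∧ Λ.comp a b = lam := by
  obtain ⟨⟨a, b⟩, h, -⟩ := Λ.factor lam m (Λ.d lam - m) (add_tsub_cancel_of_le hm).symm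
  exact ⟨a, b, h⟩

theorem seg_comp_comp {a b c : Λ.Path} (hab : Λ.s a = Λ.r b) (hbc : Λ.s b = Λ.r c) :
    Λ.seg (Λ.comp (Λ.comp a b) c) (Λ.d a) (Λ.d a + Λ.d b) = b := by
  unfold seg
  rw [← Λ.d_comp a b hab, split_comp (by rw [Λ.s_comp a b hab, hbc])]
  simp only
  rw [split_comp hab]

theorem exists_comp_comp (lam : Λ.Path) {m n : Fin k → ℕ} (hmn : m ≤ n) (hn : n ≤ Λ.d lam) :
    ∃ a b c, Λ.s a = Λ.r b ∧ Λ.s b = Λ.r c ∧ Λ.d a = m ∧ Λ.d b = n - m ∧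
      Λ.comp (Λ.comp a b) c = lam := by
  obtain ⟨e, c, hec, he, -, rfl⟩ := exists_comp lam hn
  obtain ⟨a, b, hab, ha, hb, rfl⟩ := exists_comp e (he.symm ▸ hmn : m ≤ Λ.d e)
  rw [Λ.s_comp a b hab] at hec
  exact ⟨a, b, c, hab, hec, ha, by rw [hb, he], rfl⟩

theorem seg_eq_of_comp_comp {a b c lam : Λ.Path} {m n : Fin k → ℕ} (hmn : m ≤ n)
    (hab : Λ.s a = Λ.r b) (hbc : Λ.s b = Λ.r c) (ha : Λ.d a = m) (hb : Λ.d b = n - m)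
    (h : Λ.comp (Λ.comp a b) c = lam) : Λ.seg lam m n = b := by
  have := seg_comp_comp hab hbc
  rwa [ha, hb, add_tsub_cancel_of_le hmn, h] at this

theorem d_seg (lam : Λ.Path) {m n : Fin k → ℕ} (hmn : m ≤ n) (hn : n ≤ Λ.d lam) :
    Λ.d (Λ.seg lam m n) = n - m := by
  obtain ⟨a, b, c, hab, hbc, ha, hb, h⟩ := exists_comp_comp lam hmn hn
  rw [seg_eq_of_comp_comp hmn hab hbc ha hb h, hb]

theorem r_seg (lam : Λ.Path) {m n : Fin k → ℕ} (hmn : m ≤ n) (hn : n ≤ Λ.d lam) :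
    Λ.r (Λ.seg lam m n) = Λ.seg lam m m := by
  obtain ⟨a, b, c, hab, hbc, ha, hb, h⟩ := exists_comp_comp lam hmn hn
  rw [seg_eq_of_comp_comp hmn hab hbc ha hb h]
  refine (seg_eq_of_comp_comp (a := a) (b := Λ.r b) (c := Λ.comp b c) le_rfl ?_ ?_ ha ?_ ?_).symm
  · rw [hab, Λ.r_r]
  · rw [Λ.s_r, Λ.r_comp b c hbc]
  · rw [Λ.d_r, tsub_self]
  · rw [← hab, Λ.comp_source, ← Λ.comp_assoc a b c hab hbc, h]

theorem s_seg (lam : Λ.Path) {m n : Fin k → ℕ} (hmn : m ≤ n) (hn : n ≤ Λ.d lam) :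
    Λ.s (Λ.seg lam m n) = Λ.seg lam n n := by
  obtain ⟨a, b, c, hab, hbc, ha, hb, h⟩ := exists_comp_comp lam hmn hn
  rw [seg_eq_of_comp_comp hmn hab hbc ha hb h]
  refine (seg_eq_of_comp_comp (a := Λ.comp a b) (b := Λ.s b) (c := c) le_rfl ?_ ?_ ?_ ?_ ?_).symm
  · rw [Λ.r_s, Λ.s_comp a b hab]
  · rw [Λ.s_s, hbc]
  · rw [Λ.d_comp a b hab, ha, hb, add_tsub_cancel_of_le hmn]
  · rw [Λ.d_s, tsub_self]
  · rw [← Λ.s_comp a b hab, Λ.comp_source, h]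

theorem seg_comp_left {mu nu : Λ.Path} (h : Λ.s mu = Λ.r nu) {m n : Fin k → ℕ} (hmn : m ≤ n)
    (hn : n ≤ Λ.d mu) : Λ.seg (Λ.comp mu nu) m n = Λ.seg mu m n := by
  obtain ⟨a, b, c, hab, hbc, ha, hb, rfl⟩ := exists_comp_comp mu hmn hn
  have habc : Λ.s (Λ.comp a b) = Λ.r c := by rw [Λ.s_comp a b hab, hbc]
  have hc : Λ.s c = Λ.r nu := by rw [← Λ.s_comp _ c habc, h]
  rw [seg_eq_of_comp_comp hmn hab hbc ha hb rfl]
  exact seg_eq_of_comp_comp (c := Λ.comp c nu) hmn hab (by rw [Λ.r_comp c nu hc, hbc]) ha hb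
    (Λ.comp_assoc _ c nu habc hc).symm

theorem comp_seg (lam : Λ.Path) {m n l : Fin k → ℕ} (hmn : m ≤ n) (hnl : n ≤ l)
    (hl : l ≤ Λ.d lam) :
    Λ.comp (Λ.seg lam m n) (Λ.seg lam n l) = Λ.seg lam m l := by
  obtain ⟨e, c, f, hec, hcf, he, hc, h⟩ := exists_comp_comp lam hnl hl
  obtain ⟨a, b, hab, ha, hb, rfl⟩ := exists_comp e (he.symm ▸ hmn : m ≤ Λ.d e)
  have hbc : Λ.s b = Λ.r c := by rw [← Λ.s_comp a b hab, hec]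
  rw [seg_eq_of_comp_comp hnl hec hcf he hc h]
  rw [seg_eq_of_comp_comp (b := b) (c := Λ.comp c f) hmn hab (by rw [Λ.r_comp c f hcf, hbc]) ha
    (by rw [hb, he]) (by rw [← Λ.comp_assoc _ c f hec hcf, h])]
  refine (seg_eq_of_comp_comp (c := f) (hmn.trans hnl) (by rw [Λ.r_comp b c hbc, hab])
    (by rw [Λ.s_comp b c hbc, hcf]) ha ?_ (by rw [← Λ.comp_assoc a b c hab hbc, h])).symm
  rw [Λ.d_comp b c hbc, hb, hc, he]
  funext i
  have h1 : m i ≤ n i := hmn i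
  have h2 : n i ≤ l i := hnl i
  simp only [Pi.add_apply, Pi.sub_apply]
  omega

theorem seg_zero_zero (mu : Λ.Path) : Λ.seg mu 0 0 = Λ.r mu := by
  refine seg_eq_of_comp_comp (a := Λ.r mu) (c := mu) le_rfl ?_ (Λ.s_r mu) (Λ.d_r mu) ?_ ?_
  · rw [Λ.s_r, Λ.r_r]
  · rw [Λ.d_r, tsub_self]
  · have h := Λ.comp_source (Λ.r mu)
    rw [Λ.s_r] at h
    rw [h, Λ.range_comp]

theorem IsVertex.r_eq {v : Λ.Path} (hv : Λ.IsVertex v) : Λ.r v = v :=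
  (comp_inj (a := Λ.r v) (b := v) (a' := v) (b' := Λ.s v) (Λ.s_r v) (Λ.r_s v).symm
    (by rw [Λ.d_r, hv]) (by rw [Λ.range_comp, Λ.comp_source])).1

theorem FEat.nonempty {v : Λ.Path} {E : Set Λ.Path} (h : Λ.FEat v E) : E.Nonempty := by
  obtain ⟨-, -, nu, hnu, -⟩ := h.2.2.2 v h.1.r_eq
  exact ⟨nu, hnu⟩

/-- A member of `FE(Λ)` of the form `Ext(μ;G)` has range `s(μ)`. -/
theorem FEat_s_of_Ext_mem_FE {mu : Λ.Path} {G : Set Λ.Path} (h : Λ.Ext mu G ∈ Λ.FE) :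
    Λ.FEat (Λ.s mu) (Λ.Ext mu G) := by
  obtain ⟨w, hw⟩ := h
  obtain ⟨a, ha⟩ := hw.nonempty
  rwa [← (hw.2.1 a ha).1.symm.trans ha.1]

end KGraph

namespace GMor

variable {k : ℕ} {Λ : KGraph k}

theorem seg_eq_of_seg_eq_comp (y : GMor Λ) {n u : Fin k → ℕ} (hnu : n ≤ u)
    (hu : ∀ i, (u i : ℕ∞) ≤ y.len i) {nu b : Λ.Path} (hb : Λ.s nu = Λ.r b)
    (h : y.seg n u = Λ.comp nu b) :
    (∀ i, ((n + Λ.d nu) i : ℕ∞) ≤ y.len i) ∧ y.seg n (n + Λ.d nu) = nu := by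
  have hd : u - n = Λ.d nu + Λ.d b := by rw [← y.d_seg n u hnu hu, h, Λ.d_comp nu b hb]
  have hle : n + Λ.d nu ≤ u := by
    intro i
    have h1 : n i ≤ u i := hnu i
    have h2 := congrFun hd i
    simp only [Pi.add_apply, Pi.sub_apply] at h2 ⊢
    omega
  have hlen : ∀ i, ((n + Λ.d nu) i : ℕ∞) ≤ y.len i := fun i =>
    le_trans (by exact_mod_cast hle i) (hu i)
  refine ⟨hlen, (KGraph.comp_inj (b := y.seg (n + Λ.d nu) u) ?_ hb ?_ ?_).1⟩
  · rw [y.s_seg _ _ le_self_add hlen, y.r_seg _ _ hle hu]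
  · rw [y.d_seg _ _ le_self_add hlen, add_tsub_cancel_left]
  · rw [y.comp_seg _ _ _ le_self_add hle hu, h]

theorem IsExtension.le_len {x y : GMor Λ} {lam : Λ.Path} (hy : y.IsExtension lam x)
    {n : Fin k → ℕ} (hn : ∀ i, (n i : ℕ∞) ≤ x.len i) :
    ∀ i, ((Λ.d lam + n) i : ℕ∞) ≤ y.len i := by
  intro i
  rw [hy.1 i, Pi.add_apply, Nat.cast_add]
  exact add_le_add le_rfl (hn i)

theorem IsExtension.seg_add {x y : GMor Λ} {lam : Λ.Path} (hy : y.IsExtension lam x)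
    {p q : Fin k → ℕ} (hpq : p ≤ q) (hq : ∀ i, (q i : ℕ∞) ≤ x.len i) :
    y.seg (Λ.d lam + p) (Λ.d lam + q) = x.seg p q := by
  have hp : ∀ i, (p i : ℕ∞) ≤ x.len i := fun i => le_trans (by exact_mod_cast hpq i) (hq i)
  have hpq' : Λ.d lam + p ≤ Λ.d lam + q := add_le_add le_rfl hpq
  refine (KGraph.comp_inj (a := y.seg (Λ.d lam) (Λ.d lam + p)) (a' := x.seg 0 p)
    ?_ ?_ (by rw [hy.2.2 p hp]) ?_).2
  · rw [y.s_seg _ _ le_self_add (hy.le_len hp), y.r_seg _ _ hpq' (hy.le_len hq)]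
  · rw [x.s_seg _ _ zero_le hp, x.r_seg _ _ hpq hq]
  · rw [y.comp_seg _ _ _ le_self_add hpq' (hy.le_len hq), x.comp_seg _ _ _ zero_le hpq hq,
      hy.2.2 q hq]

/-- The initial path `λ x(0, q - d(λ))` of `λx`, of degree `q ∨ d(λ)`. -/
def extInit (x : GMor Λ) (lam : Λ.Path) (q : Fin k → ℕ) : Λ.Path :=
  Λ.comp lam (x.seg 0 (q - Λ.d lam))

section Extension

variable {x : GMor Λ} {lam : Λ.Path}

theorem sub_le_len {q : Fin k → ℕ} (hq : ∀ i, (q i : ℕ∞) ≤ (Λ.d lam i : ℕ∞) + x.len i) :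
    ∀ i, ((q - Λ.d lam) i : ℕ∞) ≤ x.len i := by
  intro i
  rw [Pi.sub_apply, ENat.natCast_sub]
  exact tsub_le_iff_left.2 (hq i)

theorem s_eq_r_seg_zero (hlam : Λ.s lam = x.range) {n : Fin k → ℕ}
    (hn : ∀ i, (n i : ℕ∞) ≤ x.len i) : Λ.s lam = Λ.r (x.seg 0 n) := by
  rw [x.r_seg _ _ zero_le hn, hlam, range]

theorem le_d_extInit (hlam : Λ.s lam = x.range) {q : Fin k → ℕ}
    (hq : ∀ i, (q i : ℕ∞) ≤ (Λ.d lam i : ℕ∞) + x.len i) : q ≤ Λ.d (x.extInit lam q) := by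
  have h := sub_le_len hq
  rw [extInit, Λ.d_comp _ _ (s_eq_r_seg_zero hlam h), x.d_seg _ _ zero_le h, tsub_zero]
  exact le_add_tsub

theorem seg_extInit_mono (hlam : Λ.s lam = x.range) {p q u : Fin k → ℕ} (hpq : p ≤ q)
    (hqu : q ≤ u) (hu : ∀ i, (u i : ℕ∞) ≤ (Λ.d lam i : ℕ∞) + x.len i) :
    Λ.seg (x.extInit lam u) p q = Λ.seg (x.extInit lam q) p q := by
  have hq : ∀ i, (q i : ℕ∞) ≤ (Λ.d lam i : ℕ∞) + x.len i := fun i =>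
    le_trans (by exact_mod_cast hqu i) (hu i)
  have hu' := sub_le_len hu
  have hq' := sub_le_len hq
  have hqu' : q - Λ.d lam ≤ u - Λ.d lam := tsub_le_tsub_right hqu _
  have h1 := s_eq_r_seg_zero hlam hq'
  have h2 : Λ.s (x.seg 0 (q - Λ.d lam)) = Λ.r (x.seg (q - Λ.d lam) (u - Λ.d lam)) := by
    rw [x.s_seg _ _ zero_le hq', x.r_seg _ _ hqu' hu']
  have h3 : x.extInit lam u =
      Λ.comp (x.extInit lam q) (x.seg (q - Λ.d lam) (u - Λ.d lam)) := by
    rw [extInit, extInit, Λ.comp_assoc _ _ _ h1 h2, x.comp_seg _ _ _ zero_le hqu' hu']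
  rw [h3, KGraph.seg_comp_left _ hpq (le_d_extInit hlam hq)]
  rw [extInit, Λ.s_comp _ _ h1, h2]

/-- The underlying function of `λx`. -/
noncomputable def extendSeg (x : GMor Λ) (lam : Λ.Path) (p q : Fin k → ℕ) : Λ.Path :=
  if p ≤ q ∧ ∀ i, (q i : ℕ∞) ≤ (Λ.d lam i : ℕ∞) + x.len i then
    Λ.seg (x.extInit lam q) p q
  else Λ.r lam

theorem extendSeg_eq (hlam : Λ.s lam = x.range) {p q u : Fin k → ℕ} (hpq : p ≤ q)
    (hqu : q ≤ u) (hu : ∀ i, (u i : ℕ∞) ≤ (Λ.d lam i : ℕ∞) + x.len i) :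
    x.extendSeg lam p q = Λ.seg (x.extInit lam u) p q := by
  rw [extendSeg, if_pos ⟨hpq, fun i => le_trans (by exact_mod_cast hqu i) (hu i)⟩,
    seg_extInit_mono hlam hpq hqu hu]

/-- The extended graph morphism `λx`. -/
noncomputable def extend (x : GMor Λ) (lam : Λ.Path) (hlam : Λ.s lam = x.range) : GMor Λ where
  len i := (Λ.d lam i : ℕ∞) + x.len i
  seg := x.extendSeg lam
  d_seg p q hpq hq := by
    rw [extendSeg_eq hlam hpq le_rfl hq, KGraph.d_seg _ hpq (le_d_extInit hlam hq)]
  r_seg p q hpq hq := by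
    rw [extendSeg_eq hlam hpq le_rfl hq, extendSeg_eq hlam le_rfl hpq hq,
      KGraph.r_seg _ hpq (le_d_extInit hlam hq)]
  s_seg p q hpq hq := by
    rw [extendSeg_eq hlam hpq le_rfl hq, extendSeg_eq hlam le_rfl le_rfl hq,
      KGraph.s_seg _ hpq (le_d_extInit hlam hq)]
  comp_seg p q u hpq hqu hu := by
    rw [extendSeg_eq hlam hpq hqu hu, extendSeg_eq hlam hqu le_rfl hu,
      extendSeg_eq hlam (hpq.trans hqu) le_rfl hu,
      KGraph.comp_seg _ hpq hqu (le_d_extInit hlam hu)]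
  seg_junk p q h := by
    have h0 : ∀ i, (((0 : Fin k → ℕ) i : ℕ) : ℕ∞) ≤ (Λ.d lam i : ℕ∞) + x.len i := by simp
    rw [extendSeg_eq hlam le_rfl le_rfl h0, extendSeg, if_neg h, KGraph.seg_zero_zero, extInit,
      Λ.r_comp _ _ (s_eq_r_seg_zero hlam (sub_le_len h0))]

theorem extend_isExtension (hlam : Λ.s lam = x.range) :
    (x.extend lam hlam).IsExtension lam x := by
  have key : ∀ n : Fin k → ℕ, (∀ i, (n i : ℕ∞) ≤ x.len i) →
      ∀ i, ((Λ.d lam + n) i : ℕ∞) ≤ (Λ.d lam i : ℕ∞) + x.len i := by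
    intro n hn i
    rw [Pi.add_apply, Nat.cast_add]
    exact add_le_add le_rfl (hn i)
  refine ⟨fun i => rfl, ?_, fun n hn => ?_⟩
  · have h0 : ∀ i, (((0 : Fin k → ℕ) i : ℕ) : ℕ∞) ≤ x.len i := by simp
    have h := key 0 h0
    rw [add_zero] at h
    change x.extendSeg lam _ _ = _
    rw [extendSeg_eq hlam zero_le le_rfl h, extInit, tsub_self,
      KGraph.seg_comp_left (s_eq_r_seg_zero hlam h0) zero_le le_rfl]
    refine KGraph.seg_eq_of_comp_comp (a := Λ.r lam) (c := Λ.s lam) zero_le (Λ.s_r lam)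
      (Λ.r_s lam).symm (Λ.d_r lam) (tsub_zero _).symm ?_
    rw [Λ.range_comp, Λ.comp_source]
  · have hs := s_eq_r_seg_zero hlam hn
    change x.extendSeg lam _ _ = _
    rw [extendSeg_eq hlam le_self_add le_rfl (key n hn), extInit, add_tsub_cancel_left]
    refine KGraph.seg_eq_of_comp_comp (c := Λ.s (x.seg 0 n)) le_self_add hs (Λ.r_s _).symm rfl ?_ ?_
    · rw [x.d_seg _ _ zero_le hn, tsub_zero, add_tsub_cancel_left]
    · rw [← Λ.s_comp _ _ hs, Λ.comp_source]

end Extension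

theorem IsExtension.isBdry {𝓔 : Set (Set Λ.Path)} (h𝓔 : Λ.Satiated 𝓔) {x y : GMor Λ}
    (hx : Λ.IsBdry 𝓔 x) {lam : Λ.Path} (hy : y.IsExtension lam x) : Λ.IsBdry 𝓔 y := by
  intro n hn E hE hFE
  -- `y(n, d(λ) + p)` is the portion of `y` from `n` to `n ∨ d(λ)`
  set p : Fin k → ℕ := n - Λ.d lam
  have hp : ∀ i, (p i : ℕ∞) ≤ x.len i := sub_le_len fun i => hy.1 i ▸ hn i
  have hnm : n ≤ Λ.d lam + p := le_add_tsub
  have hm := hy.le_len hp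
  set mu := y.seg n (Λ.d lam + p)
  by_cases hmu : mu ∈ Λ.setLam E
  · obtain ⟨nu, hnu, b, hb, h⟩ := hmu
    exact ⟨nu, hnu, y.seg_eq_of_seg_eq_comp hnm hm hb h.symm⟩
  · have hext := h𝓔.2.2.1 E hE _ hFE mu (y.r_seg _ _ hnm hm) hmu
    have hFE' := KGraph.FEat_s_of_Ext_mem_FE (h𝓔.1 hext)
    rw [y.s_seg _ _ hnm hm, hy.seg_add le_rfl hp] at hFE'
    obtain ⟨a, ⟨-, nu, hnu, b, hra, hrb, hab, -⟩, hlen, hseg⟩ := hx p hp _ hext hFE'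
    have hle : Λ.d lam + p ≤ Λ.d lam + (p + Λ.d a) := add_le_add le_rfl le_self_add
    refine ⟨nu, hnu, y.seg_eq_of_seg_eq_comp (hnm.trans hle) (hy.le_len hlen) hrb ?_⟩
    rw [← y.comp_seg _ _ _ hnm hle (hy.le_len hlen), hy.seg_add le_self_add hlen, hseg, hab]

end GMor

/-- Lemma 4.5, second part: extensions `λx` of `𝓔`-compatible
boundary paths `x` by paths `λ ∈ Λ r(x)` are `𝓔`-compatible boundary paths. -/
theorem statement2 {k : ℕ} (Λ : KGraph k) (hΛ : Λ.FinitelyAligned)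
    (𝓔 : Set (Set Λ.Path)) (h𝓔 : Λ.Satiated 𝓔)
    (x : GMor Λ) (hx : Λ.IsBdry 𝓔 x)
    (lam : Λ.Path) (hlam : Λ.s lam = x.range) :
    (∃ y : GMor Λ, y.IsExtension lam x) ∧
      ∀ y : GMor Λ, y.IsExtension lam x → Λ.IsBdry 𝓔 y :=
  ⟨⟨x.extend lam hlam, GMor.extend_isExtension hlam⟩, fun _ hy => hy.isBdry h𝓔 hx⟩
end
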